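/- Let Y be a finite nonempty subset of ℝⁿ, ω ∈ ℝⁿ, g ∈ ℝⁿ, y₀ ∈ M(ω), and α > 0, with iterates ω_k = ω + k·α·g. If the better-solution set B = {y ∈ Y : ⟨y − y₀, g⟩ < 0} is nonempty, then there exists n ∈ ℕ such that y₀ ∉ M(ω_n), i.e. the solver's solution must eventually change. -/

import Mathlib

open scoped InnerProductSpace

/-- The solver's argmin set `M(ω) = {y ∈ Y : ⟨ω, y⟩ ≤ ⟨ω, y'⟩ for all y' ∈ Y}`. -/
def argminSet {n : ℕ} (Y : Finset (EuclideanSpace ℝ (Fin n)))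
    (ω : EuclideanSpace ℝ (Fin n)) : Set (EuclideanSpace ℝ (Fin n)) :=
  {y | y ∈ Y ∧ ∀ y' ∈ Y, ⟪ω, y⟫_ℝ ≤ ⟪ω, y'⟫_ℝ}


theorem identity_update_solution_changes {n : ℕ}
    (Y : Finset (EuclideanSpace ℝ (Fin n))) (hY : Y.Nonempty)
    (ω g y₀ : EuclideanSpace ℝ (Fin n)) (hy₀ : y₀ ∈ argminSet Y ω)
    (α : ℝ) (hα : 0 < α)
    (hB : ({y : EuclideanSpace ℝ (Fin n) | y ∈ Y ∧ ⟪y - y₀, g⟫_ℝ < 0}).Nonempty) :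
    ∃ m : ℕ, y₀ ∉ argminSet Y (ω + ((m : ℝ) * α) • g) := by
  obtain ⟨y, hy, hlt⟩ := hB
  rw [inner_sub_left, real_inner_comm g y, real_inner_comm g y₀] at hlt
  have hgap : 0 < α * (⟪g, y₀⟫_ℝ - ⟪g, y⟫_ℝ) := mul_pos hα (by linarith)
  obtain ⟨m, hm⟩ := exists_nat_gt ((⟪ω, y⟫_ℝ - ⟪ω, y₀⟫_ℝ) / (α * (⟪g, y₀⟫_ℝ - ⟪g, y⟫_ℝ)))
  rw [div_lt_iff₀ hgap] at hm
  refine ⟨m, fun hmem => ?_⟩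
  have hle := hmem.2 y hy
  simp only [inner_add_left, real_inner_smul_left] at hle
  linarith
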